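/- arXiv:1603.01754 — 4 statements merged into one kernel-verified Lean document; each statement's English description precedes it below -/
import Mathlib

section
/- Let Ω and Ω' be open subsets of ℝⁿ, let F : Ω → Ω' be a C¹ diffeomorphism (bijective, C¹, with everywhere invertible Jacobian DF and C¹ inverse), let γ : Ω → (n×n real matrices) be continuous, let u, v : Ω → ℝ be C¹, and let w : Ω → ℝ be continuous, with the integrand x ↦ w(x) (∇u(x) · γ(x)∇u(x)) integrable on Ω. Then ∫_Ω w(x) ∇u(x) · γ(x) ∇v(x) dx = ∫_{Ω'} w(F⁻¹(y)) ∇(u∘F⁻¹)(y) · (F_*γ)(y) ∇(v∘F⁻¹)(y) dy. In particular (taking w ≡ 1 and v = u) the Dirichlet energy satisfies E_γ(u) = E_{F_*γ}(u∘F⁻¹). -/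
open MeasureTheory Matrix

/-- The gradient of `u : ℝⁿ → ℝ`, as the vector of partial derivatives. -/
noncomputable def pgrad {n : ℕ} (u : (Fin n → ℝ) → ℝ) (x : Fin n → ℝ) : Fin n → ℝ :=
  fun j => fderiv ℝ u x (Pi.single j 1)

/-- The Jacobian matrix `DF = (∂F_i/∂x_j)` of `F : ℝⁿ → ℝⁿ`. -/
noncomputable def jac {n : ℕ} (F : (Fin n → ℝ) → (Fin n → ℝ)) (x : Fin n → ℝ) :
    Matrix (Fin n) (Fin n) ℝ :=
  Matrix.of fun i j => fderiv ℝ (fun y => F y i) x (Pi.single j 1)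

/-- The pushforward conductivity `F_*γ(y) = (DF γ DFᵀ)/|det DF| ∘ F⁻¹(y)`,
where `G` is the inverse of `F`. -/
noncomputable def pushf {n : ℕ} (F G : (Fin n → ℝ) → (Fin n → ℝ))
    (γ : (Fin n → ℝ) → Matrix (Fin n) (Fin n) ℝ) (y : Fin n → ℝ) :
    Matrix (Fin n) (Fin n) ℝ :=
  |(jac F (G y)).det|⁻¹ • (jac F (G y) * γ (G y) * (jac F (G y))ᵀ)

/-- The Jacobian matrix represents the Fréchet derivative. -/
theorem jac_eq_toMatrix' {n : ℕ} {F : (Fin n → ℝ) → (Fin n → ℝ)} {x : Fin n → ℝ}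
    (hF : DifferentiableAt ℝ F x) :
    jac F x = LinearMap.toMatrix' (fderiv ℝ F x : (Fin n → ℝ) →ₗ[ℝ] (Fin n → ℝ)) := by
  ext i j
  have h := (hasFDerivAt_pi'.1 hF.hasFDerivAt i).fderiv
  simp [jac, LinearMap.toMatrix'_apply, h, Pi.single]

theorem det_jac {n : ℕ} {F : (Fin n → ℝ) → (Fin n → ℝ)} {x : Fin n → ℝ}
    (hF : DifferentiableAt ℝ F x) : (jac F x).det = (fderiv ℝ F x).det := by
  rw [jac_eq_toMatrix' hF, LinearMap.det_toMatrix', ContinuousLinearMap.det]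

/-- The chain rule for gradients. -/
theorem pgrad_comp {n : ℕ} {F : (Fin n → ℝ) → (Fin n → ℝ)} {f : (Fin n → ℝ) → ℝ}
    {x : Fin n → ℝ} (hf : DifferentiableAt ℝ f (F x)) (hF : DifferentiableAt ℝ F x) :
    pgrad (f ∘ F) x = (jac F x)ᵀ *ᵥ pgrad f (F x) := by
  ext j
  rw [pgrad, fderiv_comp x hf hF, jac_eq_toMatrix' hF]
  simp only [ContinuousLinearMap.comp_apply, mulVec, dotProduct, transpose_apply, pgrad,
    LinearMap.toMatrix'_apply, ContinuousLinearMap.coe_coe]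
  conv_lhs => rw [pi_eq_sum_univ' (fderiv ℝ F x (Pi.single j 1))]
  simp [map_sum]

/-- A bilinear form pulled back along a matrix. -/
theorem dotProduct_mulVec_conj {n : ℕ} (A M : Matrix (Fin n) (Fin n) ℝ) (a b : Fin n → ℝ) :
    a ⬝ᵥ (A * M * Aᵀ) *ᵥ b = (Aᵀ *ᵥ a) ⬝ᵥ M *ᵥ (Aᵀ *ᵥ b) := by
  rw [← mulVec_mulVec, ← mulVec_mulVec, dotProduct_mulVec, ← mulVec_transpose]

/-- Change of variables for weighted Dirichlet integrals, with no integrability assumption. -/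
theorem setIntegral_dirichlet_pushf {n : ℕ} {Ω Ω' : Set (Fin n → ℝ)} (hΩ : IsOpen Ω)
    (hΩ' : IsOpen Ω') {F G : (Fin n → ℝ) → (Fin n → ℝ)}
    (hF : DifferentiableOn ℝ F Ω) (hG : DifferentiableOn ℝ G Ω')
    (hFbij : Set.BijOn F Ω Ω') (hGF : ∀ x ∈ Ω, G (F x) = x)
    (hJ : ∀ x ∈ Ω, (jac F x).det ≠ 0)
    (γ : (Fin n → ℝ) → Matrix (Fin n) (Fin n) ℝ)
    {u v : (Fin n → ℝ) → ℝ} (hu : DifferentiableOn ℝ u Ω) (hv : DifferentiableOn ℝ v Ω)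
    (w : (Fin n → ℝ) → ℝ) :
    (∫ x in Ω, w x * (pgrad u x ⬝ᵥ (γ x).mulVec (pgrad v x)))
      = ∫ y in Ω', w (G y) *
          (pgrad (u ∘ G) y ⬝ᵥ (pushf F G γ y).mulVec (pgrad (v ∘ G) y)) := by
  have hFx : ∀ x ∈ Ω, DifferentiableAt ℝ F x := fun x hx => hF.differentiableAt (hΩ.mem_nhds hx)
  have hgrad : ∀ {f : (Fin n → ℝ) → ℝ}, DifferentiableOn ℝ f Ω → ∀ x ∈ Ω,
      pgrad f x = (jac F x)ᵀ *ᵥ pgrad (f ∘ G) (F x) := by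
    intro f hf x hx
    have hfx : DifferentiableAt ℝ f (G (F x)) := by
      rw [hGF x hx]
      exact hf.differentiableAt (hΩ.mem_nhds hx)
    have hGx := hG.differentiableAt (hΩ'.mem_nhds (hFbij.mapsTo hx))
    have heq : f =ᶠ[nhds x] (f ∘ G) ∘ F := by
      filter_upwards [hΩ.mem_nhds hx] with z hz
      simp [hGF z hz]
    rw [← pgrad_comp (hfx.comp (F x) hGx) (hFx x hx)]
    ext j
    rw [pgrad, pgrad, heq.fderiv_eq]
  rw [← hFbij.image_eq, integral_image_eq_integral_abs_det_fderiv_smul volume hΩ.measurableSet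
    (fun x hx => (hFx x hx).hasFDerivAt.hasFDerivWithinAt) hFbij.injOn]
  refine setIntegral_congr_fun hΩ.measurableSet fun x hx => ?_
  have hdet : |(jac F x).det| ≠ 0 := abs_ne_zero.2 (hJ x hx)
  simp only [pushf, hGF x hx, ← det_jac (hFx x hx), smul_mulVec, dotProduct_smul, smul_eq_mul,
    dotProduct_mulVec_conj, ← hgrad hu x hx, ← hgrad hv x hx]
  field_simp

/-- change of variables for weighted Dirichlet-type integrals
`∫_Ω w ∇u · γ ∇v = ∫_{Ω'} (w∘F⁻¹) ∇(u∘F⁻¹) · (F_*γ) ∇(v∘F⁻¹)`; in particular the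
Dirichlet energy satisfies `E_γ(u) = E_{F_*γ}(u∘F⁻¹)`. -/
theorem stmt0 {n : ℕ} (Ω Ω' : Set (Fin n → ℝ)) (hΩ : IsOpen Ω) (hΩ' : IsOpen Ω')
    (F G : (Fin n → ℝ) → (Fin n → ℝ))
    (hF : ContDiffOn ℝ 1 F Ω) (hG : ContDiffOn ℝ 1 G Ω')
    (hFbij : Set.BijOn F Ω Ω')
    (hGF : ∀ x ∈ Ω, G (F x) = x) (hFG : ∀ y ∈ Ω', F (G y) = y)
    (hJ : ∀ x ∈ Ω, (jac F x).det ≠ 0)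
    (γ : (Fin n → ℝ) → Matrix (Fin n) (Fin n) ℝ)
    (hγ : ∀ i j, ContinuousOn (fun x => γ x i j) Ω)
    (u v : (Fin n → ℝ) → ℝ) (hu : ContDiffOn ℝ 1 u Ω) (hv : ContDiffOn ℝ 1 v Ω)
    (w : (Fin n → ℝ) → ℝ) (hw : ContinuousOn w Ω)
    (hInt : IntegrableOn (fun x => w x * (pgrad u x ⬝ᵥ (γ x).mulVec (pgrad u x))) Ω) :
    ((∫ x in Ω, w x * (pgrad u x ⬝ᵥ (γ x).mulVec (pgrad v x)))
      = ∫ y in Ω', w (G y) * (pgrad (u ∘ G) y ⬝ᵥ (pushf F G γ y).mulVec (pgrad (v ∘ G) y)))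
    ∧ (IntegrableOn (fun x => pgrad u x ⬝ᵥ (γ x).mulVec (pgrad u x)) Ω →
      (∫ x in Ω, pgrad u x ⬝ᵥ (γ x).mulVec (pgrad u x))
        = ∫ y in Ω', pgrad (u ∘ G) y ⬝ᵥ (pushf F G γ y).mulVec (pgrad (u ∘ G) y)) := by
  have hF' := hF.differentiableOn one_ne_zero
  have hG' := hG.differentiableOn one_ne_zero
  have hu' := hu.differentiableOn one_ne_zero
  have hv' := hv.differentiableOn one_ne_zero
  refine ⟨setIntegral_dirichlet_pushf hΩ hΩ' hF' hG' hFbij hGF hJ γ hu' hv' w, fun _ => ?_⟩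
  simpa only [one_mul] using
    setIntegral_dirichlet_pushf hΩ hΩ' hF' hG' hFbij hGF hJ γ hu' hu' fun _ => 1
end

section
/- Let Ω, Ω' ⊆ ℝⁿ be open, F : Ω → Ω' a C² diffeomorphism, γ : Ω → (n×n real matrices) a C¹ matrix field, and u : Ω → ℝ a C² function. If u solves the conductivity equation ∇·(γ∇u)(x) = 0 for all x ∈ Ω, then ũ := u∘F⁻¹ solves the conductivity equation with the pushforward conductivity, i.e. ∇·((F_*γ)∇ũ)(y) = 0 for all y ∈ Ω'. -/
open Matrix

/-- The divergence `∇·V = Σ_j ∂V_j/∂x_j` of a vector field `V : ℝⁿ → ℝⁿ`. -/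
noncomputable def pdiv {n : ℕ} (V : (Fin n → ℝ) → (Fin n → ℝ)) (x : Fin n → ℝ) : ℝ :=
  ∑ j, fderiv ℝ (fun y => V y j) x (Pi.single j 1)

/-- Jacobi's formula for the derivative of a determinant. -/
theorem hasFDerivAt_det {E : Type*} [NormedAddCommGroup E] [NormedSpace ℝ E] {n : ℕ}
    {M : E → Matrix (Fin n) (Fin n) ℝ} {M' : Fin n → Fin n → E →L[ℝ] ℝ} {z : E}
    (h : ∀ i j, HasFDerivAt (fun x => M x i j) (M' i j) z) :
    HasFDerivAt (fun x => (M x).det) (∑ i, ∑ j, (M z).adjugate j i • M' i j) z := by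
  let D : ContinuousMultilinearMap ℝ (fun _ : Fin n => Fin n → ℝ) ℝ :=
    { (Matrix.detRowAlternating (n := Fin n) (R := ℝ)).toMultilinearMap with
      cont := Continuous.matrix_det continuous_id }
  have hM : HasFDerivAt (fun x i j => M x i j)
      (ContinuousLinearMap.pi fun i => ContinuousLinearMap.pi fun j => M' i j) z :=
    hasFDerivAt_pi.2 fun i => hasFDerivAt_pi.2 fun j => h i j
  have hD := (D.hasFDerivAt (fun i j => M z i j)).comp z hM
  refine hD.congr_fderiv ?_
  ext v
  have key : ∀ i, ((M z).updateRow i fun j => M' i j v).det =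
      ∑ j, (M z).adjugate j i * M' i j v := by
    intro i
    rw [← Matrix.cramer_transpose_apply, Matrix.cramer_eq_adjugate_mulVec]
    simp [Matrix.mulVec, dotProduct, ← Matrix.adjugate_transpose]
  simp only [ContinuousLinearMap.comp_apply, ContinuousMultilinearMap.linearDeriv_apply,
    _root_.sum_apply, _root_.smul_apply, smul_eq_mul]
  exact Finset.sum_congr rfl fun i _ => key i

/-- The chain rule in coordinates. -/
theorem fderiv_comp_single {n : ℕ} {f : (Fin n → ℝ) → ℝ} {G : (Fin n → ℝ) → (Fin n → ℝ)}
    {z : Fin n → ℝ} (hf : DifferentiableAt ℝ f (G z)) (hG : DifferentiableAt ℝ G z) (k : Fin n) :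
    fderiv ℝ (fun x => f (G x)) z (Pi.single k 1) =
      ∑ l, fderiv ℝ f (G z) (Pi.single l 1) * jac G z l k := by
  have h1 : fderiv ℝ (fun x => f (G x)) z = (fderiv ℝ f (G z)).comp (fderiv ℝ G z) :=
    fderiv_comp z hf hG
  have h2 : ∀ l, jac G z l k = fderiv ℝ G z (Pi.single k 1) l := by
    intro l
    have := (hasFDerivAt_pi'.1 hG.hasFDerivAt l).fderiv
    simp only [jac, Matrix.of_apply]
    rw [this]
    rfl
  rw [h1, ContinuousLinearMap.comp_apply]
  conv_lhs => rw [pi_eq_sum_univ' (fderiv ℝ G z (Pi.single k 1))]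
  rw [map_sum]
  refine Finset.sum_congr rfl fun l _ => ?_
  rw [h2, map_smul, smul_eq_mul, mul_comm]

/-- The entries of the Jacobian matrix of a `C²` map are `C¹`. -/
theorem contDiffAt_jac {n : ℕ} {F : (Fin n → ℝ) → (Fin n → ℝ)} {x : Fin n → ℝ}
    (hF : ContDiffAt ℝ 2 F x) (i j : Fin n) : ContDiffAt ℝ 1 (fun z => jac F z i j) x := by
  have h : ContDiffAt ℝ 2 (fun y => F y i) x := contDiffAt_pi.1 hF i
  exact (h.fderiv_right (m := 1) (by norm_num)).clm_apply contDiffAt_const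

/-- Schwarz's theorem for the entries of the Jacobian matrix. -/
theorem fderiv_jac_symm {n : ℕ} {F : (Fin n → ℝ) → (Fin n → ℝ)} {x : Fin n → ℝ}
    (hF : ContDiffAt ℝ 2 F x) (i j k : Fin n) :
    fderiv ℝ (fun z => jac F z i j) x (Pi.single k 1) =
      fderiv ℝ (fun z => jac F z i k) x (Pi.single j 1) := by
  have h : ContDiffAt ℝ 2 (fun y => F y i) x := contDiffAt_pi.1 hF i
  have hd : DifferentiableAt ℝ (fderiv ℝ fun y => F y i) x :=
    (h.fderiv_right (m := 1) (by norm_num)).differentiableAt one_ne_zero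
  have key : ∀ a b : Fin n, fderiv ℝ (fun z => jac F z i a) x (Pi.single b 1) =
      fderiv ℝ (fderiv ℝ fun y => F y i) x (Pi.single b 1) (Pi.single a 1) := by
    intro a b
    have : HasFDerivAt (fun z => jac F z i a) _ x :=
      hd.hasFDerivAt.clm_apply (hasFDerivAt_const (Pi.single a 1) x)
    rw [this.fderiv]
    simp
  rw [key, key]
  exact (h.isSymmSndFDerivAt (by simp)) _ _

/-- The algebra of the Piola identity: the divergence of `ρ B V` for `ρ = det A`, `B = A⁻¹`, where
`dA k`, `dB k`, `dρ k` are the `k`-th partial derivatives of `A`, `B`, `ρ`. -/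
theorem piola_algebra {n : ℕ} {A B : Matrix (Fin n) (Fin n) ℝ} (hAB : A * B = 1)
    {ρ : ℝ} {dA dB : Fin n → Matrix (Fin n) (Fin n) ℝ} {dρ V : Fin n → ℝ}
    {dV : Matrix (Fin n) (Fin n) ℝ}
    (hsymm : ∀ i j k, dA k i j = dA j i k) (hdB : ∀ k, dB k * A + B * dA k = 0)
    (hdρ : ∀ k, dρ k = ρ * (B * dA k).trace) :
    ∑ i, (ρ * ∑ j, (B i j * (dV * A) j i + V j * dB i i j) + (∑ j, B i j * V j) * dρ i) =
      ρ * dV.trace := by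
  have hdB' : ∀ k, dB k = -(B * dA k * B) := by
    intro k
    have := congrArg (· * B) (eq_neg_of_add_eq_zero_left (hdB k))
    simpa [Matrix.mul_assoc, hAB] using this
  have h1 : ∑ i, ∑ j, B i j * (dV * A) j i = dV.trace := by
    have : (B * (dV * A)).trace = dV.trace := by
      rw [Matrix.trace_mul_comm, Matrix.mul_assoc, hAB, Matrix.mul_one]
    rw [← this]
    exact Finset.sum_congr rfl fun i _ => (Matrix.mul_apply (M := B)).symm
  have h2 : ∀ j, ∑ i, (dB i i j + B i j * (B * dA i).trace) = 0 := by
    intro j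
    have e1 : ∑ i, B i j * (B * dA i).trace = ∑ i, ∑ l, ∑ k, B l k * dA i k l * B i j := by
      simp only [Matrix.trace, Matrix.diag_apply, Matrix.mul_apply, Finset.mul_sum]
      refine Finset.sum_congr rfl fun _ _ => Finset.sum_congr rfl fun _ _ =>
        Finset.sum_congr rfl fun _ _ => by ring
    have e2 : ∑ i, dB i i j = -∑ l, ∑ i, ∑ k, B l k * dA l k i * B i j := by
      simp only [hdB', Matrix.neg_apply, Matrix.mul_apply, Finset.sum_mul, Finset.sum_neg_distrib]
    rw [Finset.sum_add_distrib, e1, e2, Finset.sum_comm, neg_add_eq_zero]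
    refine Finset.sum_congr rfl fun i _ => Finset.sum_congr rfl fun l _ =>
      Finset.sum_congr rfl fun k _ => by rw [hsymm]
  calc _ = ρ * (∑ i, ∑ j, B i j * (dV * A) j i) +
        ρ * ∑ i, ∑ j, V j * (dB i i j + B i j * (B * dA i).trace) := by
        simp only [Finset.mul_sum, Finset.sum_mul, ← Finset.sum_add_distrib, hdρ]
        refine Finset.sum_congr rfl fun _ _ => Finset.sum_congr rfl fun _ _ => by ring
    _ = _ := by
        rw [h1, Finset.sum_comm (f := fun i j => V j * _)]
        simp only [← Finset.mul_sum, h2, mul_zero, Finset.sum_const_zero, add_zero]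

/-- The Piola transform: the divergence of `det(DG) (DG)⁻¹ (V ∘ G)` is `det(DG) (∇·V) ∘ G`. -/
theorem pdiv_piola {n : ℕ} {G V : (Fin n → ℝ) → (Fin n → ℝ)}
    {B : (Fin n → ℝ) → Matrix (Fin n) (Fin n) ℝ} {y : Fin n → ℝ} (hG : ContDiffAt ℝ 2 G y)
    (hB : ∀ i j, DifferentiableAt ℝ (fun z => B z i j) y)
    (hBA : ∀ᶠ z in nhds y, B z * jac G z = 1)
    (hV : ∀ j, DifferentiableAt ℝ (fun x => V x j) (G y)) :
    (∀ i, DifferentiableAt ℝ (fun z => (jac G z).det * ∑ j, B z i j * V (G z) j) y) ∧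
    pdiv (fun z i => (jac G z).det * ∑ j, B z i j * V (G z) j) y =
      (jac G y).det * pdiv V (G y) := by
  have hA : ∀ i j, HasFDerivAt (fun z => jac G z i j) (fderiv ℝ (fun z => jac G z i j) y) y :=
    fun i j => ((contDiffAt_jac hG i j).differentiableAt one_ne_zero).hasFDerivAt
  have hGd : DifferentiableAt ℝ G y := hG.differentiableAt two_ne_zero
  have hdet := hasFDerivAt_det hA
  have hVG : ∀ j, DifferentiableAt ℝ (fun z => V (G z) j) y := fun j =>
    (hV j).comp (f := G) y hGd
  have hW : ∀ i, HasFDerivAt (fun z => (jac G z).det * ∑ j, B z i j * V (G z) j) _ y := fun i =>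
    hdet.mul (HasFDerivAt.fun_sum fun j _ => (hB i j).hasFDerivAt.mul (hVG j).hasFDerivAt)
  refine ⟨fun i => (hW i).differentiableAt, ?_⟩
  have hBA0 := hBA.self_of_nhds
  have hAB0 : jac G y * B y = 1 := mul_eq_one_comm.1 hBA0
  have hadj : (jac G y).adjugate = (jac G y).det • B y := by
    have := congrArg (B y * ·) (Matrix.mul_adjugate (jac G y))
    simpa [← Matrix.mul_assoc, hBA0] using this
  have := piola_algebra (A := jac G y) (B := B y) hAB0 (ρ := (jac G y).det)
    (dA := fun k => Matrix.of fun i j => fderiv ℝ (fun z => jac G z i j) y (Pi.single k 1))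
    (dB := fun k => Matrix.of fun i j => fderiv ℝ (fun z => B z i j) y (Pi.single k 1))
    (dρ := fun k => fderiv ℝ (fun z => (jac G z).det) y (Pi.single k 1))
    (V := V (G y)) (dV := jac V (G y))
    (fun i j k => fderiv_jac_symm hG i j k)
    (by
      intro k
      ext i j
      have h0 : (fun z => ∑ l, B z i l * jac G z l j) =ᶠ[nhds y]
          fun _ => (1 : Matrix (Fin n) (Fin n) ℝ) i j := by
        filter_upwards [hBA] with z hz
        rw [← hz, Matrix.mul_apply]
      have h1 : HasFDerivAt (fun z => ∑ l, B z i l * jac G z l j) _ y :=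
        HasFDerivAt.fun_sum (u := Finset.univ) fun l _ => (hB i l).hasFDerivAt.mul (hA l j)
      have h2 := h1.fderiv.symm.trans (h0.fderiv_eq.trans (fderiv_fun_const _ |> congrFun <| y))
      have h3 := congrArg (fun L => L (Pi.single k 1)) h2
      simp only [_root_.sum_apply, _root_.add_apply,
        _root_.smul_apply, smul_eq_mul] at h3
      simp only [Matrix.add_apply, Matrix.mul_apply, Matrix.of_apply, ← Finset.sum_add_distrib]
      refine Eq.trans (Finset.sum_congr rfl fun l _ => ?_) h3
      ring)
    (by
      intro k
      simp only [hdet.fderiv, hadj, _root_.sum_apply, _root_.smul_apply,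
        smul_eq_mul, Matrix.smul_apply, Matrix.trace, Matrix.diag_apply, Matrix.mul_apply,
        Matrix.of_apply, Finset.mul_sum]
      rw [Finset.sum_comm]
      refine Finset.sum_congr rfl fun _ _ => Finset.sum_congr rfl fun _ _ => by ring)
  refine Eq.trans ?_ this
  refine Finset.sum_congr rfl fun i _ => ?_
  rw [(hW i).fderiv, hdet.fderiv]
  simp only [_root_.sum_apply, _root_.add_apply,
    _root_.smul_apply, smul_eq_mul, Matrix.of_apply]
  congr 2
  refine Finset.sum_congr rfl fun j _ => ?_
  rw [fderiv_comp_single (hV j) hGd]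
  rfl

/-- if `u` solves the conductivity equation `∇·(γ∇u) = 0` on `Ω`, then
`ũ = u∘F⁻¹` solves `∇·((F_*γ)∇ũ) = 0` on `Ω'`. -/
theorem stmt3 {n : ℕ} (Ω Ω' : Set (Fin n → ℝ)) (hΩ : IsOpen Ω) (hΩ' : IsOpen Ω')
    (F G : (Fin n → ℝ) → (Fin n → ℝ))
    (hF : ContDiffOn ℝ 2 F Ω) (hG : ContDiffOn ℝ 2 G Ω')
    (hFbij : Set.BijOn F Ω Ω')
    (hGF : ∀ x ∈ Ω, G (F x) = x) (hFG : ∀ y ∈ Ω', F (G y) = y)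
    (hJ : ∀ x ∈ Ω, (jac F x).det ≠ 0)
    (γ : (Fin n → ℝ) → Matrix (Fin n) (Fin n) ℝ)
    (hγ : ∀ i j, ContDiffOn ℝ 1 (fun x => γ x i j) Ω)
    (u : (Fin n → ℝ) → ℝ) (hu : ContDiffOn ℝ 2 u Ω)
    (hsol : ∀ x ∈ Ω, pdiv (fun z => (γ z).mulVec (pgrad u z)) x = 0) :
    ∀ y ∈ Ω', pdiv (fun z => (pushf F G γ z).mulVec (pgrad (u ∘ G) z)) y = 0 := by
  intro y hy
  have hmaps : ∀ z ∈ Ω', G z ∈ Ω := by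
    intro z hz
    obtain ⟨x, hx, rfl⟩ := hFbij.surjOn hz
    rwa [hGF x hx]
  have hFat : ∀ z ∈ Ω', ContDiffAt ℝ 2 F (G z) := fun z hz =>
    hF.contDiffAt (hΩ.mem_nhds (hmaps z hz))
  have hGat : ∀ z ∈ Ω', ContDiffAt ℝ 2 G z := fun z hz => hG.contDiffAt (hΩ'.mem_nhds hz)
  have huat : ∀ z ∈ Ω', ContDiffAt ℝ 2 u (G z) := fun z hz =>
    hu.contDiffAt (hΩ.mem_nhds (hmaps z hz))
  have hGd : ∀ z ∈ Ω', DifferentiableAt ℝ G z := fun z hz =>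
    (hGat z hz).differentiableAt two_ne_zero
  have hBA : ∀ z ∈ Ω', jac F (G z) * jac G z = 1 := by
    intro z hz
    ext i j
    have hFi : DifferentiableAt ℝ (fun x => F x i) (G z) :=
      differentiableAt_pi.1 ((hFat z hz).differentiableAt two_ne_zero) i
    have hid : (fun x => F (G x) i) =ᶠ[nhds z] fun x => x i := by
      filter_upwards [hΩ'.mem_nhds hz] with x hx
      rw [hFG x hx]
    have h := fderiv_comp_single hFi (hGd z hz) j
    rw [hid.fderiv_eq, (hasFDerivAt_apply i z).fderiv] at h
    rw [Matrix.mul_apply]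
    refine h.symm.trans ?_
    simp [Pi.single_apply, Matrix.one_apply]
  have hgrad : ∀ z ∈ Ω', (jac F (G z))ᵀ.mulVec (pgrad (u ∘ G) z) = pgrad u (G z) := by
    intro z hz
    have h : pgrad (u ∘ G) z = (jac G z)ᵀ.mulVec (pgrad u (G z)) := by
      ext k
      refine (fderiv_comp_single ((huat z hz).differentiableAt two_ne_zero) (hGd z hz) k).trans ?_
      simp [Matrix.mulVec, dotProduct, pgrad, mul_comm]
    rw [h, Matrix.mulVec_mulVec, ← Matrix.transpose_mul, mul_eq_one_comm.1 (hBA z hz),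
      Matrix.transpose_one, Matrix.one_mulVec]
  have hdetmul : ∀ z ∈ Ω', (jac F (G z)).det * (jac G z).det = 1 := by
    intro z hz
    rw [← Matrix.det_mul, hBA z hz, Matrix.det_one]
  have habs : ∀ z ∈ Ω', |(jac F (G z)).det|⁻¹ = |(jac G z).det| := by
    intro z hz
    rw [← abs_inv, inv_eq_of_mul_eq_one_right (hdetmul z hz)]
  have hcont : ContinuousAt (fun z => (jac G z).det) y :=
    (hasFDerivAt_det fun i j => ((contDiffAt_jac (hGat y hy) i j).differentiableAt
      one_ne_zero).hasFDerivAt).continuousAt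
  obtain ⟨s, hs⟩ : ∃ s : ℝ, ∀ᶠ z in nhds y, |(jac G z).det| = s * (jac G z).det := by
    rcases lt_or_gt_of_ne (right_ne_zero_of_mul_eq_one (hdetmul y hy)) with h | h
    · refine ⟨-1, (hcont.eventually_lt_const h).mono fun z hz => ?_⟩
      rw [abs_of_neg hz, neg_one_mul]
    · refine ⟨1, (hcont.eventually_const_lt h).mono fun z hz => ?_⟩
      rw [abs_of_pos hz, one_mul]
  have hV : ∀ j, DifferentiableAt ℝ (fun x => (γ x).mulVec (pgrad u x) j) (G y) := by
    intro j
    have hg : ∀ k, DifferentiableAt ℝ (fun x => pgrad u x k) (G y) := fun k =>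
      (((huat y hy).fderiv_right (m := 1) (by norm_num)).clm_apply
        contDiffAt_const).differentiableAt one_ne_zero
    have hγ' : ∀ k, DifferentiableAt ℝ (fun x => γ x j k) (G y) := fun k =>
      ((hγ j k).contDiffAt (hΩ.mem_nhds (hmaps y hy))).differentiableAt one_ne_zero
    exact DifferentiableAt.fun_sum (u := Finset.univ) fun k _ => (hγ' k).fun_mul (hg k)
  obtain ⟨hWd, hW⟩ := pdiv_piola (V := fun x => (γ x).mulVec (pgrad u x))
    (B := fun z => jac F (G z)) (hGat y hy)
    (fun i j => ((contDiffAt_jac (hFat y hy) i j).differentiableAt one_ne_zero).comp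
      (f := G) y (hGd y hy))
    (Filter.eventually_of_mem (hΩ'.mem_nhds hy) hBA) hV
  rw [hsol _ (hmaps y hy), mul_zero] at hW
  have hfield : ∀ i, (fun z => (pushf F G γ z).mulVec (pgrad (u ∘ G) z) i) =ᶠ[nhds y]
      fun z => s * ((jac G z).det *
        ∑ j, jac F (G z) i j * (γ (G z)).mulVec (pgrad u (G z)) j) := by
    intro i
    filter_upwards [hs, hΩ'.mem_nhds hy] with z hz hzΩ
    rw [pushf, habs z hzΩ, hz, Matrix.smul_mulVec, ← Matrix.mulVec_mulVec, hgrad z hzΩ,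
      ← Matrix.mulVec_mulVec, Pi.smul_apply, smul_eq_mul, mul_assoc]
    rfl
  have hfd : ∀ i, fderiv ℝ (fun z => (pushf F G γ z).mulVec (pgrad (u ∘ G) z) i) y
      (Pi.single i 1) = s * fderiv ℝ (fun z => (jac G z).det *
        ∑ j, jac F (G z) i j * (γ (G z)).mulVec (pgrad u (G z)) j) y (Pi.single i 1) := by
    intro i
    rw [(hfield i).fderiv_eq, fderiv_const_mul (hWd i)]
    rfl
  calc _ = ∑ i, s * _ := Finset.sum_congr rfl fun i _ => hfd i
    _ = s * _ := (Finset.mul_sum _ _ _).symm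
    _ = 0 := mul_eq_zero_of_right s hW
end

section
/- Let n ≥ 1, let k ∈ ℂ with k ≠ 0, let g : ℝ² → ℂ be n-times continuously differentiable, and let r : ℝ² → ℂ be continuously differentiable with (2∂ + i k̄) r = g on ℝ². Define the remainder r^{(n)} := (i k̄)^{n} ( r − Σ_{j=1}^{n} (−2∂)^{j−1} g / (i k̄)^{j} ). Then r^{(n)} satisfies (2∂ + i k̄) r^{(n)} = (−2∂)^{n} g on ℝ², i.e. r admits the expansion r = Σ_{j=1}^{n} (−2∂)^{j−1} g/(i k̄)^{j} + r^{(n)}/(i k̄)^{n} with remainder solving the same type of equation with source (−2∂)^{n} g. -/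
open ComplexConjugate

/-- The Wirtinger operator `∂ = ½(∂_{x₁} − i∂_{x₂})` acting on functions `ℝ² → ℂ`. -/
noncomputable def wd (f : ℝ × ℝ → ℂ) (x : ℝ × ℝ) : ℂ :=
  (1 / 2) * (fderiv ℝ f x (1, 0) - Complex.I * fderiv ℝ f x (0, 1))

/-- The operator `−2∂`; its `j`-fold iterate is `(−2∂)^j`. -/
noncomputable def negTwoD : (ℝ × ℝ → ℂ) → (ℝ × ℝ → ℂ) := fun f x => (-2) * wd f x

theorem wd_const_mul_sub (c : ℂ) {f h : ℝ × ℝ → ℂ} {x : ℝ × ℝ}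
    (hf : DifferentiableAt ℝ f x) (hh : DifferentiableAt ℝ h x) :
    wd (fun y => c * f y - h y) x = c * wd f x - wd h x := by
  have hd : HasFDerivAt (fun y => c * f y - h y) (c • fderiv ℝ f x - fderiv ℝ h x) x :=
    (hf.hasFDerivAt.const_mul c).sub hh.hasFDerivAt
  simp only [wd, hd.fderiv, sub_apply, smul_apply, smul_eq_mul]
  ring

theorem ContDiff.negTwoD {m : ℕ} {f : ℝ × ℝ → ℂ} (hf : ContDiff ℝ (m + 1 : ℕ) f) :
    ContDiff ℝ m (negTwoD f) := by
  have hd : ContDiff ℝ m (fderiv ℝ f) := hf.fderiv_right (by norm_cast)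
  exact contDiff_const.mul (contDiff_const.mul ((hd.clm_apply contDiff_const).sub
    (contDiff_const.mul (hd.clm_apply contDiff_const))))

theorem ContDiff.iterate_negTwoD {m : ℕ} (j : ℕ) {f : ℝ × ℝ → ℂ}
    (hf : ContDiff ℝ (m + j : ℕ) f) : ContDiff ℝ m (_root_.negTwoD^[j] f) := by
  induction j generalizing f with
  | zero => exact hf
  | succ j ih => exact ih (ContDiff.negTwoD hf)

/-- The remainder after `n` terms of the expansion of `r` in powers of `1 / c`. -/
noncomputable def remainder (c : ℂ) (g r : ℝ × ℝ → ℂ) (n : ℕ) (y : ℝ × ℝ) : ℂ :=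
  c ^ n * (r y - ∑ j ∈ Finset.range n, (negTwoD^[j] g) y / c ^ (j + 1))

theorem remainder_succ {c : ℂ} (hc : c ≠ 0) (g r : ℝ × ℝ → ℂ) (n : ℕ) :
    remainder c g r (n + 1) = fun y => c * remainder c g r n y - (negTwoD^[n] g) y := by
  funext y
  simp only [remainder, Finset.sum_range_succ]
  field_simp
  ring

theorem differentiable_remainder (c : ℂ) {g r : ℝ × ℝ → ℂ} {n : ℕ}
    (hg : ContDiff ℝ n g) (hr : Differentiable ℝ r) :
    Differentiable ℝ (remainder c g r n) := by
  have hG : ∀ j ∈ Finset.range n, Differentiable ℝ fun y => (negTwoD^[j] g) y / c ^ (j + 1) := by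
    intro j hj
    have hjn : 1 + j ≤ n := by simpa [add_comm] using Finset.mem_range.mp hj
    have hd : ContDiff ℝ (1 : ℕ) (negTwoD^[j] g) :=
      ContDiff.iterate_negTwoD j (hg.of_le (by exact_mod_cast hjn))
    simp only [div_eq_mul_inv]
    exact (hd.differentiable (by norm_num)).mul_const _
  exact (hr.sub (Differentiable.fun_sum hG)).const_mul _

theorem two_mul_wd_remainder_add {c : ℂ} (hc : c ≠ 0) {g r : ℝ × ℝ → ℂ} {n : ℕ}
    (hg : ContDiff ℝ n g) (hr : Differentiable ℝ r)
    (heq : ∀ x, 2 * wd r x + c * r x = g x) (x : ℝ × ℝ) :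
    2 * wd (remainder c g r n) x + c * remainder c g r n x = (negTwoD^[n] g) x := by
  induction n with
  | zero =>
    have h0 : remainder c g r 0 = r := by
      funext y
      simp [remainder]
    simpa [h0] using heq x
  | succ n ih =>
    have hgn : ContDiff ℝ n g := hg.of_le (by norm_cast; omega)
    have hG : ContDiff ℝ (1 : ℕ) (negTwoD^[n] g) :=
      ContDiff.iterate_negTwoD n (by rwa [add_comm])
    rw [remainder_succ hc, wd_const_mul_sub c (differentiable_remainder c hgn hr x)
      (hG.differentiable (by norm_num) x), Function.iterate_succ_apply']
    simp only [negTwoD] at ih ⊢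
    linear_combination c * ih hgn

/-- if `(2∂ + ik̄)r = g` on `ℝ²` with `g ∈ Cⁿ`, `r ∈ C¹`, `k ≠ 0`, then the
remainder `r⁽ⁿ⁾ = (ik̄)ⁿ(r − Σ_{j=1}^{n} (−2∂)^{j−1}g/(ik̄)^j)` satisfies
`(2∂ + ik̄)r⁽ⁿ⁾ = (−2∂)ⁿ g` on `ℝ²`. -/
theorem stmt14 (n : ℕ) (hn : 1 ≤ n) (k : ℂ) (hk : k ≠ 0) (g r : ℝ × ℝ → ℂ)
    (hg : ContDiff ℝ n g) (hr : ContDiff ℝ 1 r)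
    (heq : ∀ x : ℝ × ℝ, 2 * wd r x + Complex.I * conj k * r x = g x) :
    ∀ x : ℝ × ℝ,
      2 * wd (fun y => (Complex.I * conj k) ^ n *
          (r y - ∑ j ∈ Finset.range n, (negTwoD^[j] g) y / (Complex.I * conj k) ^ (j + 1))) x
        + Complex.I * conj k * ((Complex.I * conj k) ^ n *
          (r x - ∑ j ∈ Finset.range n, (negTwoD^[j] g) x / (Complex.I * conj k) ^ (j + 1)))
      = (negTwoD^[n] g) x := by
  exact two_mul_wd_remainder_add (mul_ne_zero Complex.I_ne_zero ((map_ne_zero _).mpr hk)) hg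
    (hr.differentiable one_ne_zero) heq
end

section
/- Let f : ℂ → ℂ be continuously differentiable with compact support, and define its Cauchy transform Pf(z) := (1/(2π)) ∫_ℂ f(w)/(z − w) dA(w), where dA is Lebesgue measure on ℂ ≅ ℝ². Then Pf is differentiable and 2 ∂̄ (Pf)(z) = f(z) for every z ∈ ℂ; that is, the Cauchy transform (with this normalization) is a right inverse of the operator 2∂̄. -/
open MeasureTheory

/-- The Cauchy transform `Pf(z) = (1/(2π)) ∫_ℂ f(w)/(z − w) dA(w)`. -/
noncomputable def cauchyTransform (f : ℂ → ℂ) (z : ℂ) : ℂ :=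
  (1 / (2 * (Real.pi : ℂ))) * ∫ w : ℂ, f w / (z - w)

open Convolution in
/-- The Cauchy transform is the convolution with the Cauchy kernel. -/
theorem cauchyTransform_eq_convolution (f : ℂ → ℂ) :
    cauchyTransform f = fun z ↦ (1 / (2 * (Real.pi : ℂ))) *
      ((fun w : ℂ ↦ w⁻¹) ⋆[ContinuousLinearMap.mul ℝ ℂ, volume] f) z := by
  ext z
  rw [cauchyTransform, convolution_def, ← integral_sub_left_eq_self _ volume z]
  simp [div_eq_inv_mul]

theorem locallyIntegrable_inv_complex : LocallyIntegrable (fun w : ℂ ↦ w⁻¹) := by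
  refine locallyIntegrable_of_norm_le_rpow (C := 1) (α := 1) ?_ ?_ ?_ ?_
  · simp
  · norm_num [Complex.finrank_real_complex]
  · refine Filter.Eventually.of_forall fun w ↦ ?_
    simp [Real.rpow_neg_one]
  · exact measurable_inv.aestronglyMeasurable

/-- A continuous function on the half-strip which vanishes for large radii is integrable. -/
theorem integrableOn_polar_of_continuous {h : ℝ × ℝ → ℂ} (hc : Continuous h) {R : ℝ}
    (hR : ∀ p : ℝ × ℝ, R < p.1 → h p = 0) :
    IntegrableOn h (Set.Ioi 0 ×ˢ Set.Ioo (-Real.pi) Real.pi) := by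
  have hK : IntegrableOn h (Set.Icc 0 R ×ˢ Set.Icc (-Real.pi) Real.pi) :=
    hc.continuousOn.integrableOn_compact (isCompact_Icc.prod isCompact_Icc)
  refine hK.of_forall_sdiff_eq_zero (measurableSet_Ioi.prod measurableSet_Ioo) ?_
  rintro ⟨r, θ⟩ ⟨⟨h0, h1⟩, h2⟩
  apply hR
  by_contra! hle
  exact h2 ⟨⟨le_of_lt h0, hle⟩, Set.Ioo_subset_Icc_self h1⟩

/-- A real-linear map `D` satisfies `D 1 + i D i = u (D u + i D (i u))` for unimodular `u`. -/
theorem dbar_rotate (D : ℂ →L[ℝ] ℂ) {u : ℂ} (hu : ‖u‖ = 1) :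
    D 1 + Complex.I * D Complex.I = u * (D u + Complex.I * D (Complex.I * u)) := by
  have key : ∀ v : ℂ, D v = v.re * D 1 + v.im * D Complex.I := by
    intro v
    conv_lhs => rw [show v = v.re • (1 : ℂ) + v.im • Complex.I by
      simp [Complex.re_add_im], map_add, map_smul, map_smul]
    simp only [Complex.real_smul]
  have hu2 : (u.re : ℂ) ^ 2 + (u.im : ℂ) ^ 2 = 1 := by
    have := Complex.normSq_eq_norm_sq u
    rw [hu, Complex.normSq_apply] at this
    have h2 : u.re ^ 2 + u.im ^ 2 = 1 := by nlinarith
    exact_mod_cast h2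
  have hue : u = u.re + u.im * Complex.I := (Complex.re_add_im u).symm
  rw [key u, key (Complex.I * u)]
  generalize D 1 = a
  generalize D Complex.I = b
  simp only [Complex.mul_re, Complex.mul_im, Complex.I_re, Complex.I_im]
  generalize u.re = x at *
  generalize u.im = y at *
  subst hue
  push_cast
  linear_combination (-a - Complex.I * b) * hu2 +
    (-b * x * y + y ^ 2 * a) * Complex.I_sq

theorem hasDerivAt_exp_mul_I (θ : ℝ) :
    HasDerivAt (fun θ : ℝ ↦ Complex.exp (θ * Complex.I))
      (Complex.I * Complex.exp (θ * Complex.I)) θ := by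
  have h := ((Complex.ofRealCLM.hasDerivAt (x := θ)).mul_const Complex.I).cexp
  simpa [mul_comm] using h

/-- Integrating the radial derivative along a ray recovers the value at the origin. -/
theorem integral_fderiv_ray {f : ℂ → ℂ} (hf : ContDiff ℝ 1 f) (hsupp : HasCompactSupport f)
    (z : ℂ) {u : ℂ} (hu : ‖u‖ = 1) :
    ∫ r in Set.Ioi (0 : ℝ), fderiv ℝ f (z - r * u) u = f z := by
  have hd : ∀ r : ℝ, HasDerivAt (fun r : ℝ ↦ f (z - r * u)) (-(fderiv ℝ f (z - r * u) u)) r := by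
    intro r
    have h1 : HasDerivAt (fun r : ℝ ↦ z - r * u) (-u) r := by
      simpa using ((Complex.ofRealCLM.hasDerivAt (x := r)).mul_const u).const_sub z
    simpa [Function.comp_def] using
      (hf.differentiable one_ne_zero _).hasFDerivAt.comp_hasDerivAt r h1
  have hcd : ContDiff ℝ 1 (fun r : ℝ ↦ f (z - r * u)) :=
    hf.comp (contDiff_const.sub (Complex.ofRealCLM.contDiff.mul contDiff_const))
  have hcs : HasCompactSupport (fun r : ℝ ↦ f (z - r * u)) := by
    refine hsupp.comp_isClosedEmbedding (g := fun r : ℝ ↦ z - r * u) ?_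
    refine Isometry.isClosedEmbedding (Isometry.of_dist_eq fun a b ↦ ?_)
    rw [dist_sub_left, dist_eq_norm, ← sub_mul, norm_mul, hu, mul_one, ← Complex.ofReal_sub,
      Complex.norm_real, dist_eq_norm]
  have := hcs.integral_Ioi_deriv_eq hcd 0
  simp only [fun r ↦ (hd r).deriv, integral_neg] at this
  simpa using this

/-- The tangential derivative integrates to zero over a circle. -/
theorem integral_fderiv_circle {f : ℂ → ℂ} (hf : ContDiff ℝ 1 f) (z : ℂ) {r : ℝ} (hr : r ≠ 0) :
    ∫ θ in Set.Ioo (-Real.pi) Real.pi, fderiv ℝ f (z - r * Complex.exp (θ * Complex.I))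
      (Complex.I * Complex.exp (θ * Complex.I)) = 0 := by
  set B : ℝ → ℂ := fun θ ↦ fderiv ℝ f (z - r * Complex.exp (θ * Complex.I))
      (Complex.I * Complex.exp (θ * Complex.I)) with hB
  have hd : ∀ θ : ℝ, HasDerivAt (fun θ : ℝ ↦ f (z - r * Complex.exp (θ * Complex.I)))
      ((-r) • B θ) θ := by
    intro θ
    have h1 := ((hasDerivAt_exp_mul_I θ).const_mul (r : ℂ)).const_sub z
    have h2 := (hf.differentiable one_ne_zero _).hasFDerivAt.comp_hasDerivAt θ h1
    convert! h2 using 1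
    rw [hB, ← map_smul]
    simp
  have hBc : Continuous B :=
    ((hf.continuous_fderiv one_ne_zero).comp (by fun_prop)).clm_apply (by fun_prop)
  have h := intervalIntegral.integral_eq_sub_of_hasDerivAt (a := -Real.pi) (b := Real.pi)
    (fun θ _ ↦ hd θ) ((hBc.const_smul (-r)).intervalIntegrable _ _)
  rw [intervalIntegral.integral_smul, intervalIntegral.integral_of_le (by linarith [Real.pi_pos]),
    integral_Ioc_eq_integral_Ioo] at h
  have he : Complex.exp (-(Real.pi * Complex.I)) = -1 := by
    rw [Complex.exp_neg, Complex.exp_pi_mul_I]; norm_num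
  simpa [hr, he] using h

theorem integral_inv_mul_dbar {f : ℂ → ℂ} (hf : ContDiff ℝ 1 f) (hsupp : HasCompactSupport f)
    (z : ℂ) :
    ∫ t : ℂ, t⁻¹ * (fderiv ℝ f (z - t) 1 + Complex.I * fderiv ℝ f (z - t) Complex.I) =
      2 * Real.pi * f z := by
  set e : ℝ → ℂ := fun θ ↦ Complex.exp (θ * Complex.I) with he
  have hen : ∀ θ, ‖e θ‖ = 1 := Complex.norm_exp_ofReal_mul_I
  have hec : Continuous e := by fun_prop
  set A : ℝ × ℝ → ℂ := fun p ↦ fderiv ℝ f (z - p.1 * e p.2) (e p.2) with hA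
  set B : ℝ × ℝ → ℂ := fun p ↦ fderiv ℝ f (z - p.1 * e p.2) (Complex.I * e p.2) with hB
  have hDc : Continuous fun p : ℝ × ℝ ↦ fderiv ℝ f (z - p.1 * e p.2) :=
    (hf.continuous_fderiv one_ne_zero).comp (by fun_prop)
  obtain ⟨R, hR⟩ := (hsupp.fderiv ℝ).isCompact.isBounded.subset_closedBall z
  have hD0 : ∀ p : ℝ × ℝ, max R 0 < p.1 → fderiv ℝ f (z - p.1 * e p.2) = 0 := by
    intro p hp
    by_contra hne
    have := hR (subset_tsupport _ hne)
    rw [Metric.mem_closedBall, dist_eq_norm, sub_sub_cancel_left, norm_neg, norm_mul, hen,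
      mul_one, Complex.norm_real, Real.norm_eq_abs] at this
    linarith [le_abs_self p.1, le_max_left R 0]
  have hAi := integrableOn_polar_of_continuous (h := A)
    (hDc.clm_apply (by fun_prop)) (R := max R 0) fun p hp ↦ by simp [hA, hD0 p hp]
  have hBi := integrableOn_polar_of_continuous (h := B)
    (hDc.clm_apply (by fun_prop)) (R := max R 0) fun p hp ↦ by simp [hB, hD0 p hp]
  have hAint : ∫ p in Set.Ioi (0 : ℝ) ×ˢ Set.Ioo (-Real.pi) Real.pi, A p =
      2 * Real.pi * f z := by
    rw [Measure.volume_eq_prod, ← setIntegral_prod_swap,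
      setIntegral_prod (fun p ↦ A p.swap) hAi.swap]
    simp only [hA, Prod.swap, integral_fderiv_ray hf hsupp z (hen _)]
    simp [Real.pi_pos.le, two_mul]
  have hBint : ∫ p in Set.Ioi (0 : ℝ) ×ˢ Set.Ioo (-Real.pi) Real.pi, B p = 0 := by
    rw [Measure.volume_eq_prod, setIntegral_prod _ hBi]
    exact setIntegral_eq_zero_of_forall_eq_zero fun r hr ↦
      integral_fderiv_circle hf z (ne_of_gt hr)
  rw [← Complex.integral_comp_polarCoord_symm]
  calc _ = ∫ p in Set.Ioi (0 : ℝ) ×ˢ Set.Ioo (-Real.pi) Real.pi, (A p + Complex.I * B p) := by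
        refine setIntegral_congr_fun (measurableSet_Ioi.prod measurableSet_Ioo) fun p hp ↦ ?_
        have hp0 : (p.1 : ℂ) ≠ 0 := by exact_mod_cast (ne_of_gt hp.1 : p.1 ≠ 0)
        have hs : Complex.polarCoord.symm p = p.1 * e p.2 := by
          simp [he, Complex.exp_mul_I]
        have he0 : e p.2 ≠ 0 := Complex.exp_ne_zero _
        simp only [hs, dbar_rotate _ (hen p.2), Complex.real_smul, hA, hB]
        field_simp
    _ = 2 * Real.pi * f z := by
        rw [integral_add hAi (hBi.const_mul _), integral_const_mul, hAint, hBint]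
        simp

open Convolution in
/-- for `f : ℂ → ℂ` continuously differentiable with compact support, the
Cauchy transform `Pf` is differentiable and `2∂̄(Pf) = f`, where
`∂̄ = ½(∂_{x₁} + i∂_{x₂})`; i.e. the Cauchy transform is a right inverse of `2∂̄`. -/
theorem stmt15 (f : ℂ → ℂ) (hf : ContDiff ℝ 1 f) (hsupp : HasCompactSupport f) :
    Differentiable ℝ (cauchyTransform f) ∧
    ∀ z : ℂ,
      2 * ((1 / 2) * (fderiv ℝ (cauchyTransform f) z 1
            + Complex.I * fderiv ℝ (cauchyTransform f) z Complex.I))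
        = f z := by
  have hk := locallyIntegrable_inv_complex
  have hder : ∀ z, HasFDerivAt (cauchyTransform f) ((1 / (2 * (Real.pi : ℂ))) •
      ((fun w : ℂ ↦ w⁻¹) ⋆[(ContinuousLinearMap.mul ℝ ℂ).precompR ℂ, volume] fderiv ℝ f) z) z := by
    intro z
    rw [cauchyTransform_eq_convolution]
    exact (hsupp.hasFDerivAt_convolution_right _ hk hf z).const_mul _
  refine ⟨fun z ↦ (hder z).differentiableAt, fun z ↦ ?_⟩
  have hc := hf.continuous_fderiv one_ne_zero
  have hint : ∀ v : ℂ, Integrable fun t : ℂ ↦ t⁻¹ * fderiv ℝ f (z - t) v := fun v ↦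
    ((hsupp.fderiv ℝ).comp_left (g := fun D : ℂ →L[ℝ] ℂ ↦ D v) rfl).convolutionExists_right
      (ContinuousLinearMap.mul ℝ ℂ) hk (hc.clm_apply continuous_const) z
  have happ : ∀ v : ℂ, fderiv ℝ (cauchyTransform f) z v =
      (1 / (2 * (Real.pi : ℂ))) * ∫ t : ℂ, t⁻¹ * fderiv ℝ f (z - t) v := by
    intro v
    rw [(hder z).fderiv, smul_apply,
      convolution_precompR_apply _ hk (hsupp.fderiv ℝ) hc, convolution_def, smul_eq_mul]
    rfl
  have hsum := integral_inv_mul_dbar hf hsupp z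
  simp only [mul_add, mul_left_comm _ Complex.I] at hsum
  rw [integral_add (hint 1) ((hint Complex.I).const_mul _), integral_const_mul] at hsum
  have hpi : (Real.pi : ℂ) ≠ 0 := by exact_mod_cast Real.pi_ne_zero
  rw [happ, happ]
  generalize (∫ t : ℂ, t⁻¹ * fderiv ℝ f (z - t) 1) = a at hsum ⊢
  generalize (∫ t : ℂ, t⁻¹ * fderiv ℝ f (z - t) Complex.I) = b at hsum ⊢
  field_simp
  linear_combination hsum
end
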